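/- Let T be a finite totally ordered set, G a finite grid poset, and S ⊆ T × G a spread. If x is a cover of S, then π₀(x) ∈ π₀(min S ∪ (max S + e₀)). In particular, the aligned subgrid π₀(min S ∪ (max S + e₀)) × G contains min(S) and cover(S). -/

import Mathlib

namespace SpreadPaper

section Order

variable (P : Type) [PartialOrder P]

def upSet (S : Set P) : Set P := {p | ∃ s ∈ S, s ≤ p}

def IsConvex (S : Set P) : Prop := ∀ ⦃a b c : P⦄, a ∈ S → c ∈ S → a ≤ b → b ≤ c → b ∈ S

def ZigzagStep (S : Set P) (a b : P) : Prop := a ∈ S ∧ b ∈ S ∧ (a ≤ b ∨ b ≤ a)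

def IsPosetConnected (S : Set P) : Prop :=
  S.Nonempty ∧ ∀ a ∈ S, ∀ b ∈ S, Relation.ReflTransGen (ZigzagStep P S) a b

def IsSpread (S : Set P) : Prop := IsConvex P S ∧ IsPosetConnected P S

def minimalsIn (S : Set P) : Set P := {s ∈ S | ∀ t ∈ S, t ≤ s → t = s}

def maximalsIn (S : Set P) : Set P := {s ∈ S | ∀ t ∈ S, s ≤ t → s = t}

def coverSet (S : Set P) : Set P := minimalsIn P (upSet P S \ S)

end Order

/-- Truncated successor in `[m₀] = Fin m₀`: `a + 1`, capped at `m₀ - 1`. -/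
def truncSucc {m : ℕ} (a : Fin m) : Fin m :=
  ⟨min (m - 1) (a.val + 1), by have := a.isLt; omega⟩

/-- The operation `x ↦ x + e₀` on `T × G`, increasing the `T`-coordinate by one
(truncated at the top). -/
def addE0 {m : ℕ} {G : Type} (x : Fin m × G) : Fin m × G := (truncSucc x.1, x.2)

theorem exists_minimalsIn_le {P : Type} [PartialOrder P] [Finite P] {S : Set P} {a : P}
    (ha : a ∈ S) : ∃ b ∈ minimalsIn P S, b ≤ a := by
  obtain ⟨b, hba, hb⟩ := S.toFinite.exists_le_minimal ha
  exact ⟨b, ⟨hb.prop, fun t ht htb => le_antisymm htb (hb.le_of_le ht htb)⟩, hba⟩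

theorem exists_le_maximalsIn {P : Type} [PartialOrder P] [Finite P] {S : Set P} {a : P}
    (ha : a ∈ S) : ∃ b ∈ maximalsIn P S, a ≤ b := by
  obtain ⟨b, hab, hb⟩ := S.toFinite.exists_le_maximal ha
  exact ⟨b, ⟨hb.prop, fun t ht hbt => le_antisymm hbt (hb.le_of_ge ht hbt)⟩, hab⟩

/-- Only convexity of `S` is needed, and `G` may be any finite partial order. -/
theorem fst_mem_of_mem_coverSet {m : ℕ} {G : Type} [PartialOrder G] [Finite G]
    {S : Set (Fin m × G)} (hS : IsConvex (Fin m × G) S) {x : Fin m × G}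
    (hx : x ∈ coverSet (Fin m × G) S) :
    x.1 ∈ Prod.fst '' (minimalsIn (Fin m × G) S ∪ addE0 '' maximalsIn (Fin m × G) S) := by
  obtain ⟨⟨⟨a, haS, hax⟩, hxS⟩, hmin⟩ := hx
  obtain ⟨s, hs, hsa⟩ := exists_minimalsIn_le haS
  have hsx : s ≤ x := hsa.trans hax
  rcases hsx.1.eq_or_lt with h | h
  · exact ⟨s, Or.inl hs, h⟩
  have hlt : s.1.val < x.1.val := h
  have hm := x.1.isLt
  -- The element directly below `x` in the `T`-direction lies in `S`.
  set y : Fin m × G := (⟨x.1.val - 1, by omega⟩, x.2)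
  have hyx : y ≤ x := ⟨Fin.le_def.2 (Nat.sub_le _ _), le_rfl⟩
  have hsy : s ≤ y := ⟨Fin.le_def.2 (Nat.le_sub_one_of_lt hlt), hsx.2⟩
  have hyS : y ∈ S := by
    by_contra hyS
    have heq : x.1.val - 1 = x.1.val :=
      congrArg (fun p => p.1.val) (hmin y ⟨⟨s, hs.1, hsy⟩, hyS⟩ hyx)
    omega
  obtain ⟨z, hz, hyz⟩ := exists_le_maximalsIn hyS
  refine ⟨addE0 z, Or.inr ⟨z, hz, rfl⟩, Fin.ext ?_⟩
  have hzx : ¬ x.1 ≤ z.1 := fun hle => hxS (hS hyS hz.1 hyx ⟨hle, hyz.2⟩)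
  have hzlt : z.1.val < x.1.val := not_le.1 hzx
  have hyz1 : x.1.val - 1 ≤ z.1.val := hyz.1
  change min (m - 1) (z.1.val + 1) = x.1.val
  omega

/-- **Lemma.** Let `T = [m₀]` be a finite total order, `G` a finite grid poset, and
`S ⊆ T × G` a spread. If `x` is a cover of `S`, then
`π₀(x) ∈ π₀(min S ∪ (max S + e₀))`. In particular, the aligned subgrid
`π₀(min S ∪ (max S + e₀)) × G` contains `min S` and `cover S`. -/
theorem statement18 (m : ℕ) (n : ℕ) (F : Fin n → Type)
    [∀ i, LinearOrder (F i)] [∀ i, Fintype (F i)]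
    (S : Set (Fin m × (∀ i, F i))) (hS : IsSpread (Fin m × (∀ i, F i)) S) :
    (∀ x ∈ coverSet (Fin m × (∀ i, F i)) S,
      x.1 ∈ Prod.fst '' (minimalsIn (Fin m × (∀ i, F i)) S ∪
        addE0 '' maximalsIn (Fin m × (∀ i, F i)) S)) ∧
    (minimalsIn (Fin m × (∀ i, F i)) S ∪ coverSet (Fin m × (∀ i, F i)) S ⊆
      (Prod.fst '' (minimalsIn (Fin m × (∀ i, F i)) S ∪
        addE0 '' maximalsIn (Fin m × (∀ i, F i)) S)) ×ˢ (Set.univ : Set (∀ i, F i))) := by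
  have hcover := fun x hx => fst_mem_of_mem_coverSet (x := x) hS.1 hx
  refine ⟨hcover, ?_⟩
  rintro x (hx | hx)
  · exact ⟨⟨x, Or.inl hx, rfl⟩, trivial⟩
  · exact ⟨hcover x hx, trivial⟩

end SpreadPaper
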